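/- For all real parameters c₁, c₂, c₃, the sixth moment of the Bell-diagonal matrix ρ_BD(c₁,c₂,c₃) satisfies R^(6) = (8/735)(c₁⁶ + c₂⁶ + c₃⁶) − (486/245)(R^(2))³ + (135/49) R^(2) R^(4), where R^(2) = (c₁²+c₂²+c₃²)/9 and R^(4) = (2(c₁⁴+c₂⁴+c₃⁴) + (c₁²+c₂²+c₃²)²)/75. -/

import Mathlib

open MeasureTheory Matrix Kronecker

noncomputable section

abbrev E3 : Type := EuclideanSpace ℝ (Fin 3)

/-- The unit sphere `S²` in `ℝ³`. -/
abbrev S2 : Type := Metric.sphere (0 : E3) 1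

/-- The action of a linear isometry (rotation) of `ℝ³` on the unit sphere. -/
def sphereMap (f : E3 ≃ₗᵢ[ℝ] E3) (x : S2) : S2 :=
  ⟨f x, by
    have h : ‖(x : E3)‖ = 1 := by simpa using mem_sphere_zero_iff_norm.mp x.2
    simp [mem_sphere_zero_iff_norm, h]⟩

/-- The three Pauli matrices `σ_x, σ_y, σ_z`. -/
def pauli : Fin 3 → Matrix (Fin 2) (Fin 2) ℂ
  | 0 => !![0, 1; 1, 0]
  | 1 => !![0, -Complex.I; Complex.I, 0]
  | 2 => !![1, 0; 0, -1]

/-- For a direction `u ∈ ℝ³`, the operator `σ_u = u₁σ₁ + u₂σ₂ + u₃σ₃`. -/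
def pauliVec (u : Fin 3 → ℝ) : Matrix (Fin 2) (Fin 2) ℂ :=
  ∑ j, (u j : ℂ) • pauli j

/-- The coordinates of a point of the unit sphere `S²`. -/
def coords (x : S2) : Fin 3 → ℝ := fun j => (x : E3) j

/-- The Bell-diagonal matrix `ρ_BD = (1/4)(I₄ + Σ_j c_j σ_j ⊗ σ_j)`. -/
def rhoBD (c₁ c₂ c₃ : ℝ) : Matrix (Fin 2 × Fin 2) (Fin 2 × Fin 2) ℂ :=
  (1 / 4 : ℂ) • (1 + (c₁ : ℂ) • (pauli 0 ⊗ₖ pauli 0) + (c₂ : ℂ) • (pauli 1 ⊗ₖ pauli 1)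
    + (c₃ : ℂ) • (pauli 2 ⊗ₖ pauli 2))

/-- The `t`-th moment `R^(t) = ∬_{S²×S²} (Tr[ρ (σ_u ⊗ σ_w)])^t dμ(u) dμ(w)` of a two-qubit
matrix `ρ` with respect to a measure `μ` on the sphere. -/
def twoQubitMoment (μ : Measure S2) (ρ : Matrix (Fin 2 × Fin 2) (Fin 2 × Fin 2) ℂ)
    (t : ℕ) : ℝ :=
  ∫ p : S2 × S2,
    ((ρ * (pauliVec (coords p.1) ⊗ₖ pauliVec (coords p.2))).trace).re ^ t ∂(μ.prod μ)

open scoped InnerProductSpace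

lemma continuous_sphereMap (f : E3 ≃ₗᵢ[ℝ] E3) : Continuous (sphereMap f) :=
  (f.continuous.comp continuous_subtype_val).subtype_mk _

lemma integrable_of_continuous_of_compactSpace {X : Type*} [TopologicalSpace X] [CompactSpace X]
    [MeasurableSpace X] [OpensMeasurableSpace X] (μ : Measure X)
    [IsFiniteMeasure μ] {g : X → ℝ} (hg : Continuous g) : Integrable g μ :=
  hg.integrable_of_hasCompactSupport (HasCompactSupport.of_compactSpace g)

lemma integral_sum_mul_of_continuous {ι X : Type*} [Fintype ι] [TopologicalSpace X]
    [CompactSpace X] [MeasurableSpace X] [OpensMeasurableSpace X]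
    (μ : Measure X) [IsFiniteMeasure μ] (r : ι → ℝ) {g : ι → X → ℝ}
    (hg : ∀ k, Continuous (g k)) :
    ∫ x, ∑ k, r k * g k x ∂μ = ∑ k, r k * ∫ x, g k x ∂μ := by
  rw [integral_finsetSum _ fun k _ =>
    (integrable_of_continuous_of_compactSpace μ (hg k)).const_mul (r k)]
  simp only [integral_const_mul]

lemma integral_comp_sphereMap {μ : Measure S2}
    (hinv : ∀ f : E3 ≃ₗᵢ[ℝ] E3, μ.map (sphereMap f) = μ) (f : E3 ≃ₗᵢ[ℝ] E3) {g : S2 → ℝ}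
    (hg : Continuous g) : ∫ x, g (sphereMap f x) ∂μ = ∫ x, g x ∂μ := by
  conv_rhs => rw [← hinv f]
  exact (integral_map (continuous_sphereMap f).aemeasurable hg.aestronglyMeasurable).symm

lemma integral_inner_pow_eq_of_norm_eq {μ : Measure S2}
    (hinv : ∀ f : E3 ≃ₗᵢ[ℝ] E3, μ.map (sphereMap f) = μ) {a b : E3} (hab : ‖a‖ = ‖b‖) (n : ℕ) :
    ∫ x : S2, ⟪a, (x : E3)⟫_ℝ ^ n ∂μ = ∫ x : S2, ⟪b, (x : E3)⟫_ℝ ^ n ∂μ := by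
  rw [← integral_comp_sphereMap hinv (Submodule.reflection (ℝ ∙ (a - b))ᗮ)
    (g := fun x : S2 => ⟪b, (x : E3)⟫_ℝ ^ n) (by fun_prop)]
  congr 1 with x
  have h := (Submodule.reflection (ℝ ∙ (a - b))ᗮ).inner_map_map a x
  rw [Submodule.reflection_sub hab] at h
  simp only [sphereMap, h]

lemma integral_inner_pow_six {μ : Measure S2}
    (hinv : ∀ f : E3 ≃ₗᵢ[ℝ] E3, μ.map (sphereMap f) = μ) (a : E3) :
    ∫ x : S2, ⟪a, (x : E3)⟫_ℝ ^ 6 ∂μ = (‖a‖ ^ 2) ^ 3 * ∫ x : S2, (x : E3) 0 ^ 6 ∂μ := by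
  rw [integral_inner_pow_eq_of_norm_eq hinv (b := ‖a‖ • EuclideanSpace.single 0 1) (by
    simp [norm_smul])]
  simp only [real_inner_smul_left, EuclideanSpace.inner_single_left, map_one, one_mul, mul_pow,
    integral_const_mul]
  ring

lemma integral_sum_linear_pow_six {ι : Type*} [Fintype ι] {μ : Measure S2} [IsFiniteMeasure μ]
    (hinv : ∀ f : E3 ≃ₗᵢ[ℝ] E3, μ.map (sphereMap f) = μ) (r : ι → ℝ) (a : ι → Fin 3 → ℝ) :
    ∫ x : S2, ∑ k, r k * (∑ i, a k i * (x : E3) i) ^ 6 ∂μ =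
      (∑ k, r k * (∑ i, a k i ^ 2) ^ 3) * ∫ x : S2, (x : E3) 0 ^ 6 ∂μ := by
  rw [integral_sum_mul_of_continuous μ r (by fun_prop), Finset.sum_mul]
  refine Finset.sum_congr rfl fun k _ => ?_
  have h := integral_inner_pow_six hinv (WithLp.toLp 2 (a k))
  simp only [EuclideanSpace.norm_sq_eq, PiLp.inner_apply, RCLike.inner_apply, conj_trivial,
    Real.norm_eq_abs, sq_abs] at h
  rw [mul_assoc, ← h]
  simp only [mul_comm]

/-- Proved by writing the integrand as a combination of sixth powers of linear forms. -/
lemma integral_diagonal_quadratic_pow_three_eq_mul {μ : Measure S2} [IsFiniteMeasure μ]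
    (hinv : ∀ f : E3 ≃ₗᵢ[ℝ] E3, μ.map (sphereMap f) = μ) (p q r : ℝ) :
    ∫ x : S2, (p * (x : E3) 0 ^ 2 + q * (x : E3) 1 ^ 2 + r * (x : E3) 2 ^ 2) ^ 3 ∂μ =
      (p ^ 3 + q ^ 3 + r ^ 3 + 3 / 5 * (p ^ 2 * q + p ^ 2 * r + q ^ 2 * p + q ^ 2 * r
        + r ^ 2 * p + r ^ 2 * q) + 2 / 5 * (p * q * r)) * ∫ x : S2, (x : E3) 0 ^ 6 ∂μ := by
  have h := integral_sum_linear_pow_six hinv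
    ![p ^ 3 - p ^ 2 * q - p ^ 2 * r + (q ^ 2 * p + r ^ 2 * p) / 20 + p * q * r / 15,
      q ^ 3 - q ^ 2 * p - q ^ 2 * r + (p ^ 2 * q + r ^ 2 * q) / 20 + p * q * r / 15,
      r ^ 3 - r ^ 2 * p - r ^ 2 * q + (p ^ 2 * r + q ^ 2 * r) / 20 + p * q * r / 15,
      -(p ^ 2 * q + q ^ 2 * p + p * q * r) / 30, -(p ^ 2 * q + q ^ 2 * p + p * q * r) / 30,
      -(p ^ 2 * r + r ^ 2 * p + p * q * r) / 30, -(p ^ 2 * r + r ^ 2 * p + p * q * r) / 30,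
      -(q ^ 2 * r + r ^ 2 * q + p * q * r) / 30, -(q ^ 2 * r + r ^ 2 * q + p * q * r) / 30,
      p ^ 2 * q / 120, p ^ 2 * q / 120, q ^ 2 * p / 120, q ^ 2 * p / 120,
      p ^ 2 * r / 120, p ^ 2 * r / 120, r ^ 2 * p / 120, r ^ 2 * p / 120,
      q ^ 2 * r / 120, q ^ 2 * r / 120, r ^ 2 * q / 120, r ^ 2 * q / 120,
      p * q * r / 60, p * q * r / 60, p * q * r / 60, p * q * r / 60]
    ![![1, 0, 0], ![0, 1, 0], ![0, 0, 1],
      ![1, 1, 0], ![1, -1, 0], ![1, 0, 1], ![1, 0, -1], ![0, 1, 1], ![0, 1, -1],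
      ![2, 1, 0], ![2, -1, 0], ![1, 2, 0], ![1, -2, 0],
      ![2, 0, 1], ![2, 0, -1], ![1, 0, 2], ![1, 0, -2],
      ![0, 2, 1], ![0, 2, -1], ![0, 1, 2], ![0, 1, -2],
      ![1, 1, 1], ![1, 1, -1], ![1, -1, 1], ![1, -1, -1]]
  simp only [Fin.sum_univ_succ, Fin.sum_univ_zero, Matrix.cons_val_zero, Matrix.cons_val_succ,
    Fin.succ_zero_eq_one, Fin.succ_one_eq_two, Matrix.cons_val_one, Matrix.cons_val, add_zero,
    zero_mul, zero_add, one_mul] at h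
  refine Eq.trans (integral_congr_ae (.of_forall fun x => ?_)) (h.trans ?_)
  · ring
  · ring

lemma integral_diagonal_quadratic_pow_three {μ : Measure S2} [IsProbabilityMeasure μ]
    (hinv : ∀ f : E3 ≃ₗᵢ[ℝ] E3, μ.map (sphereMap f) = μ) (p q r : ℝ) :
    ∫ x : S2, (p * (x : E3) 0 ^ 2 + q * (x : E3) 1 ^ 2 + r * (x : E3) 2 ^ 2) ^ 3 ∂μ =
      (p ^ 3 + q ^ 3 + r ^ 3 + 3 / 5 * (p ^ 2 * q + p ^ 2 * r + q ^ 2 * p + q ^ 2 * r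
        + r ^ 2 * p + r ^ 2 * q) + 2 / 5 * (p * q * r)) / 7 := by
  have hsphere (x : S2) : (x : E3) 0 ^ 2 + (x : E3) 1 ^ 2 + (x : E3) 2 ^ 2 = 1 := by
    have h : ‖(x : E3)‖ ^ 2 = 1 := by simp
    rw [EuclideanSpace.norm_sq_eq] at h
    simpa only [Fin.sum_univ_three, Real.norm_eq_abs, sq_abs] using h
  have h := integral_diagonal_quadratic_pow_three_eq_mul hinv 1 1 1
  simp only [one_mul, hsphere, one_pow, integral_const, probReal_univ, smul_eq_mul, mul_one] at h
  rw [integral_diagonal_quadratic_pow_three_eq_mul hinv]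
  linear_combination (-1 / 7) * (p ^ 3 + q ^ 3 + r ^ 3 + 3 / 5 * (p ^ 2 * q + p ^ 2 * r
    + q ^ 2 * p + q ^ 2 * r + r ^ 2 * p + r ^ 2 * q) + 2 / 5 * (p * q * r)) * h

lemma integral_linear_pow_six {μ : Measure S2} [IsProbabilityMeasure μ]
    (hinv : ∀ f : E3 ≃ₗᵢ[ℝ] E3, μ.map (sphereMap f) = μ) (a : Fin 3 → ℝ) :
    ∫ x : S2, (∑ i, a i * (x : E3) i) ^ 6 ∂μ = (∑ i, a i ^ 2) ^ 3 / 7 := by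
  have h := integral_sum_linear_pow_six hinv (fun _ : Unit => 1) (fun _ => a)
  have h0 := integral_diagonal_quadratic_pow_three hinv 1 0 0
  simp [← pow_mul] at h h0
  rw [h, h0]
  ring

lemma trace_rhoBD_mul_re (c₁ c₂ c₃ : ℝ) (u w : Fin 3 → ℝ) :
    ((rhoBD c₁ c₂ c₃ * (pauliVec u ⊗ₖ pauliVec w)).trace).re =
      c₁ * u 0 * w 0 + c₂ * u 1 * w 1 + c₃ * u 2 * w 2 := by
  simp [rhoBD, pauliVec, pauli, Matrix.trace, Matrix.mul_apply, Fintype.sum_prod_type,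
    Fin.sum_univ_three, Matrix.one_apply]
  ring

/-- for all real `c₁, c₂, c₃`, the sixth moment of the Bell-diagonal matrix
`ρ_BD(c₁,c₂,c₃)` satisfies
`R^(6) = (8/735)(c₁⁶+c₂⁶+c₃⁶) − (486/245)(R^(2))³ + (135/49) R^(2) R^(4)`,
where `R^(2) = (c₁²+c₂²+c₃²)/9` and `R^(4) = (2(c₁⁴+c₂⁴+c₃⁴)+(c₁²+c₂²+c₃²)²)/75`.
Here `μ` is the rotation-invariant (uniform) probability measure on `S²`. -/
theorem bellDiagonal_sixth_moment (c₁ c₂ c₃ : ℝ)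
    (μ : Measure S2) [IsProbabilityMeasure μ]
    (hinv : ∀ f : E3 ≃ₗᵢ[ℝ] E3, μ.map (sphereMap f) = μ) :
    twoQubitMoment μ (rhoBD c₁ c₂ c₃) 6 =
      (8 / 735) * (c₁ ^ 6 + c₂ ^ 6 + c₃ ^ 6)
        - (486 / 245) * ((c₁ ^ 2 + c₂ ^ 2 + c₃ ^ 2) / 9) ^ 3
        + (135 / 49) * ((c₁ ^ 2 + c₂ ^ 2 + c₃ ^ 2) / 9) *
            ((2 * (c₁ ^ 4 + c₂ ^ 4 + c₃ ^ 4) + (c₁ ^ 2 + c₂ ^ 2 + c₃ ^ 2) ^ 2) / 75) := by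

  have hint : Integrable (fun p : S2 × S2 => (c₁ * coords p.1 0 * coords p.2 0
      + c₂ * coords p.1 1 * coords p.2 1 + c₃ * coords p.1 2 * coords p.2 2) ^ 6) (μ.prod μ) :=
    integrable_of_continuous_of_compactSpace _ (by unfold coords; fun_prop)
  have hinner (u : S2) : ∫ w : S2, (c₁ * coords u 0 * coords w 0
      + c₂ * coords u 1 * coords w 1 + c₃ * coords u 2 * coords w 2) ^ 6 ∂μ =
      (c₁ ^ 2 * (u : E3) 0 ^ 2 + c₂ ^ 2 * (u : E3) 1 ^ 2 + c₃ ^ 2 * (u : E3) 2 ^ 2) ^ 3 / 7 := by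
    have h := integral_linear_pow_six hinv
      ![c₁ * (u : E3) 0, c₂ * (u : E3) 1, c₃ * (u : E3) 2]
    simpa [coords, Fin.sum_univ_three, mul_pow] using h
  simp only [twoQubitMoment, trace_rhoBD_mul_re]
  rw [integral_prod _ hint]
  simp only [hinner, integral_div]
  rw [integral_diagonal_quadratic_pow_three hinv]
  ring
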